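/- For the scalar Gaussian channel Y = √snr · X + N with E[X^2] < ∞ and snr > 0, the Fisher information of the output, J(Y) = E[((d/dy) log p_Y(Y))^2], satisfies J(Y) = 1 − snr · mmse(snr). -/

import Mathlib

open MeasureTheory ProbabilityTheory Real Filter
open scoped ENNReal NNReal Topology

noncomputable section

open scoped Classical in
/-- Kullback–Leibler divergence `D(μ ‖ ν)` in nats, with values in `[0, ∞]`. -/
def klDiv {α : Type*} [MeasurableSpace α] (μ ν : Measure α) : ℝ≥0∞ :=
  if μ ≪ ν ∧ Integrable (llr μ ν) μ then ENNReal.ofReal (∫ x, llr μ ν x ∂μ) else ⊤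

/-- Mutual information `I(A; B)` in nats: the KL divergence of the joint law of `(A, B)`
from the product of its marginals. -/
def mutualInfo {Ω α β : Type*} [MeasurableSpace Ω] [MeasurableSpace α] [MeasurableSpace β]
    (μ : Measure Ω) (A : Ω → α) (B : Ω → β) : ℝ≥0∞ :=
  klDiv (μ.map fun ω => (A ω, B ω)) ((μ.map A).prod (μ.map B))

/-- Output `Y = √snr · X + N` of the scalar Gaussian channel at signal-to-noise ratio `snr`. -/
def chOut {Ω : Type*} (X N : Ω → ℝ) (snr : ℝ) : Ω → ℝ := fun ω => Real.sqrt snr * X ω + N ω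

/-- Minimum mean-square error `E[(X - E[X | Y])²]` of estimating `X` given `Y`. -/
def mmse {Ω : Type*} [MeasurableSpace Ω] (μ : Measure Ω) (X Y : Ω → ℝ) : ℝ :=
  ∫ ω, (X ω - (μ[X | MeasurableSpace.comap Y inferInstance]) ω) ^ 2 ∂μ

/-- Density `p_Y(y) = E[(2π)^{-1/2} exp(−(y − √snr·X)²/2)]` of the output of the scalar
Gaussian channel `Y = √snr · X + N`. -/
def outDensity1 {Ω : Type*} [MeasurableSpace Ω] (μ : Measure Ω) (X : Ω → ℝ) (snr : ℝ)
    (y : ℝ) : ℝ :=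
  ∫ ω, (Real.sqrt (2 * π))⁻¹ * Real.exp (-(y - Real.sqrt snr * X ω) ^ 2 / 2) ∂μ

/-- Standard Gaussian density. -/
def phiG (u : ℝ) : ℝ := (Real.sqrt (2 * π))⁻¹ * Real.exp (-u ^ 2 / 2)

lemma phiG_pos (u : ℝ) : 0 < phiG u := by unfold phiG; positivity

lemma phiG_cont : Continuous phiG := by unfold phiG; fun_prop

lemma phiG_le (u : ℝ) : phiG u ≤ (Real.sqrt (2 * π))⁻¹ := by
  unfold phiG
  have h : Real.exp (-u ^ 2 / 2) ≤ 1 := by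
    rw [Real.exp_le_one_iff]; nlinarith [sq_nonneg u]
  have h0 : 0 ≤ (Real.sqrt (2 * π))⁻¹ := by positivity
  nlinarith

lemma abs_mul_phiG_le (u : ℝ) : |u * phiG u| ≤ (Real.sqrt (2 * π))⁻¹ := by
  have h0 : 0 ≤ (Real.sqrt (2 * π))⁻¹ := by positivity
  rw [abs_mul, abs_of_pos (phiG_pos u)]
  unfold phiG
  have h : |u| * Real.exp (-u ^ 2 / 2) ≤ 1 := by
    have h1 : |u| ≤ Real.exp (u ^ 2 / 2) := by
      have h2 := Real.add_one_le_exp (u ^ 2 / 2)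
      have h3 : |u| ^ 2 = u ^ 2 := sq_abs u
      nlinarith [sq_nonneg (|u| - 1)]
    have h4 : Real.exp (-u ^ 2 / 2) = (Real.exp (u ^ 2 / 2))⁻¹ := by
      rw [← Real.exp_neg]; congr 1; ring
    rw [h4, ← div_eq_mul_inv]
    exact div_le_one_of_le₀ h1 (Real.exp_pos _).le
  calc |u| * ((Real.sqrt (2 * π))⁻¹ * Real.exp (-u ^ 2 / 2))
      = (Real.sqrt (2 * π))⁻¹ * (|u| * Real.exp (-u ^ 2 / 2)) := by ring
    _ ≤ _ := by nlinarith

lemma hasDerivAt_phiG (u : ℝ) : HasDerivAt phiG (-(u * phiG u)) u := by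
  unfold phiG
  have h : HasDerivAt (fun u : ℝ => -u ^ 2 / 2) (-u) u := by
    have := ((hasDerivAt_pow 2 u).neg).div_const 2
    refine HasDerivAt.congr_deriv this ?_
    push_cast
    ring
  have := (h.exp).const_mul ((Real.sqrt (2 * π))⁻¹)
  refine HasDerivAt.congr_deriv this ?_
  ring

lemma gaussianPDF_phiG (u : ℝ) : gaussianPDF 0 1 u = ENNReal.ofReal (phiG u) := by
  simp [gaussianPDF, gaussianPDFReal, phiG]

section
variable (ν : Measure ℝ) [IsProbabilityMeasure ν] (s : ℝ)

lemma integrable_phiG (y : ℝ) : Integrable (fun x => phiG (y - s * x)) ν := by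
  refine Integrable.of_bound (C := (Real.sqrt (2 * π))⁻¹)
    (phiG_cont.comp (by fun_prop)).aestronglyMeasurable ?_
  refine ae_of_all _ fun x => ?_
  rw [Real.norm_eq_abs, abs_of_pos (phiG_pos _)]
  exact phiG_le _

lemma density_pos (y : ℝ) : 0 < ∫ x, phiG (y - s * x) ∂ν := by
  rw [integral_pos_iff_support_of_nonneg (fun x => (phiG_pos _).le) (integrable_phiG ν s y)]
  have : Function.support (fun x => phiG (y - s * x)) = Set.univ := by
    ext x; simp [(phiG_pos (y - s * x)).ne']
  rw [this]; simp

lemma hasDerivAt_density (y : ℝ) :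
    HasDerivAt (fun y => ∫ x, phiG (y - s * x) ∂ν)
      (∫ x, -((y - s * x) * phiG (y - s * x)) ∂ν) y := by
  have hc : Continuous fun x : ℝ => phiG (y - s * x) := phiG_cont.comp (by fun_prop)
  refine (hasDerivAt_integral_of_dominated_loc_of_deriv_le (μ := ν)
    (F := fun y x => phiG (y - s * x))
    (F' := fun y x => -((y - s * x) * phiG (y - s * x)))
    (bound := fun _ => (Real.sqrt (2 * π))⁻¹) (s := Set.univ) Filter.univ_mem
    ?_ (integrable_phiG ν s y) ?_ ?_ (integrable_const _) ?_).2
  · exact Eventually.of_forall fun z => (integrable_phiG ν s z).aestronglyMeasurable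
  · exact Continuous.aestronglyMeasurable (by fun_prop)
  · refine ae_of_all _ fun x z _ => ?_
    rw [norm_neg]; exact abs_mul_phiG_le _
  · refine ae_of_all _ fun x z _ => ?_
    have h := (hasDerivAt_phiG (z - s * x)).comp z ((hasDerivAt_id z).sub_const (s * x))
    simpa [Function.comp_def] using h

lemma deriv_log_density (y : ℝ) :
    deriv (fun y => Real.log (∫ x, phiG (y - s * x) ∂ν)) y * (∫ x, phiG (y - s * x) ∂ν)
      = - ∫ x, (y - s * x) * phiG (y - s * x) ∂ν := by
  rw [((hasDerivAt_density ν s y).log (density_pos ν s y).ne').deriv,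
    div_mul_cancel₀ _ (density_pos ν s y).ne', integral_neg]

end

lemma joint_law {Ω : Type*} [MeasurableSpace Ω] (μ : Measure Ω) [IsProbabilityMeasure μ]
    (X N : Ω → ℝ) (hX : Measurable X) (hN : Measurable N)
    (hXN : IndepFun X N μ) (hN_law : μ.map N = gaussianReal 0 1) (s : ℝ) :
    μ.map (fun ω => (X ω, s * X ω + N ω)) =
      ((μ.map X).prod volume).withDensity
        (fun z => ENNReal.ofReal (phiG (z.2 - s * z.1))) := by
  have : IsProbabilityMeasure (μ.map X) := Measure.isProbabilityMeasure_map hX.aemeasurable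
  have h1 := hXN.map_prod_eq_prod_map_map hX.aemeasurable hN.aemeasurable
  rw [hN_law, gaussianReal_of_var_ne_zero 0 one_ne_zero,
    prod_withDensity_right (measurable_gaussianPDF 0 1)] at h1
  let e : ℝ × ℝ → ℝ × ℝ := fun z => (z.1, s * z.1 + z.2)
  have he : MeasurePreserving e ((μ.map X).prod volume) ((μ.map X).prod volume) :=
    (MeasurePreserving.id (μ.map X)).skew_product (g := fun x n => s * x + n)
      (by simp only [Function.uncurry_def]; fun_prop)
      (ae_of_all _ fun x => (measurePreserving_add_left volume (s * x)).map_eq)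
  have h2 : μ.map (fun ω => (X ω, s * X ω + N ω)) = (μ.map fun ω => (X ω, N ω)).map e := by
    rw [Measure.map_map he.measurable (hX.prodMk hN)]; rfl
  have hD : Measurable fun z : ℝ × ℝ => ENNReal.ofReal (phiG (z.2 - s * z.1)) :=
    (phiG_cont.measurable.comp (by fun_prop)).ennreal_ofReal
  rw [h2, h1]
  ext A hA
  rw [Measure.map_apply he.measurable hA, withDensity_apply _ (he.measurable hA),
    withDensity_apply _ hA, ← he.setLIntegral_comp_preimage hA hD]
  refine lintegral_congr fun z => ?_
  rw [gaussianPDF_phiG]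
  simp [e]

/-- **Fisher information and MMSE**: for the scalar Gaussian channel `Y = √snr · X + N` with
`E[X²] < ∞` and `snr > 0`, the Fisher information of the output satisfies
`J(Y) = E[((d/dy) log p_Y(Y))²] = 1 − snr · mmse(snr)`. -/
theorem fisherInfo_eq_one_sub_snr_mmse
    {Ω : Type*} [MeasurableSpace Ω] (μ : Measure Ω) [IsProbabilityMeasure μ]
    (X N : Ω → ℝ) (hX : Measurable X) (hN : Measurable N)
    (hXN : IndepFun X N μ)
    (hN_law : μ.map N = gaussianReal 0 1)
    (hX2 : Integrable (fun ω => X ω ^ 2) μ)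
    (snr : ℝ) (hsnr : 0 < snr) :
    ∫ ω, (deriv (fun t => Real.log (outDensity1 μ X snr t)) (chOut X N snr ω)) ^ 2 ∂μ
      = 1 - snr * mmse μ X (chOut X N snr) := by
  set s := Real.sqrt snr with hs
  have hs2 : s ^ 2 = snr := Real.sq_sqrt hsnr.le
  set ν := μ.map X with hν
  have hνp : IsProbabilityMeasure ν := Measure.isProbabilityMeasure_map hX.aemeasurable
  set Y := chOut X N snr with hY
  have hYm : Measurable Y := by
    simp only [hY]; unfold chOut; fun_prop
  have hYe : ∀ ω, Y ω = s * X ω + N ω := fun ω => rfl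
  have hp : ∀ t, outDensity1 μ X snr t = ∫ x, phiG (t - s * x) ∂ν := by
    intro t
    have hc : Continuous fun x : ℝ => phiG (t - s * x) := phiG_cont.comp (by fun_prop)
    rw [hν, integral_map hX.aemeasurable hc.aestronglyMeasurable]
    rfl
  simp only [hp]
  set g : ℝ → ℝ := deriv (fun t => Real.log (∫ x, phiG (t - s * x) ∂ν)) with hg
  have hgm : Measurable g := measurable_deriv _
  have hgp : ∀ y, g y * (∫ x, phiG (y - s * x) ∂ν) = - ∫ x, (y - s * x) * phiG (y - s * x) ∂ν :=
    deriv_log_density ν s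
  have hjoint := joint_law μ X N hX hN hXN hN_law s
  rw [← hν] at hjoint
  have hpair : Measurable (fun ω => (X ω, s * X ω + N ω)) := by fun_prop
  have hD : Measurable fun z : ℝ × ℝ => ENNReal.ofReal (phiG (z.2 - s * z.1)) :=
    (phiG_cont.measurable.comp (by fun_prop)).ennreal_ofReal
  -- transfer lemmas
  have hTransInt : ∀ F : ℝ × ℝ → ℝ, Measurable F →
      (Integrable (fun ω => F (X ω, Y ω)) μ ↔
        Integrable (fun z => phiG (z.2 - s * z.1) * F z) (ν.prod volume)) := by
    intro F hF
    have h1 := integrable_map_measure (μ := μ) (f := fun ω => (X ω, s * X ω + N ω)) (g := F)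
      hF.aestronglyMeasurable hpair.aemeasurable
    rw [hjoint, integrable_withDensity_iff_integrable_smul' hD (by simp)] at h1
    simp only [ENNReal.toReal_ofReal (phiG_pos _).le, smul_eq_mul] at h1
    exact h1.symm
  have hTransEq : ∀ F : ℝ × ℝ → ℝ, Measurable F →
      ∫ ω, F (X ω, Y ω) ∂μ = ∫ z, phiG (z.2 - s * z.1) * F z ∂(ν.prod volume) := by
    intro F hF
    have h1 := integral_map (μ := μ) (φ := fun ω => (X ω, s * X ω + N ω)) (f := F)
      hpair.aemeasurable hF.aestronglyMeasurable
    rw [hjoint, integral_withDensity_eq_integral_toReal_smul hD (by simp)] at h1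
    simp only [ENNReal.toReal_ofReal (phiG_pos _).le, smul_eq_mul] at h1
    exact h1.symm
  -- moments
  have hN2 : MemLp N 2 μ := by
    have h := memLp_id_gaussianReal (μ := 0) (v := 1) 2
    rw [← hN_law] at h
    exact (memLp_map_measure_iff aestronglyMeasurable_id hN.aemeasurable).1 h
  have hNi : Integrable N μ := hN2.integrable (by norm_num)
  have hXL2 : MemLp X 2 μ := (memLp_two_iff_integrable_sq hX.aestronglyMeasurable).2 hX2
  have hXi : Integrable X μ := hXL2.integrable (by norm_num)
  have hYi : Integrable Y μ := (hXi.const_mul s).add hNi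
  have hN0 : ∫ ω, N ω ∂μ = 0 := by
    have h := integral_id_gaussianReal (μ := 0) (v := 1)
    rw [← hN_law, integral_map hN.aemeasurable (by fun_prop)] at h
    exact h
  have hNvar : Var[N; μ] = 1 := by
    have h := variance_id_gaussianReal (μ := 0) (v := 1)
    rw [← hN_law, variance_map (by fun_prop) hN.aemeasurable] at h
    simpa using h
  -- integrability of the score
  have hNF : Integrable (fun z : ℝ × ℝ => phiG (z.2 - s * z.1) * (z.2 - s * z.1))
      (ν.prod volume) := by
    refine (hTransInt (fun z => z.2 - s * z.1) (by fun_prop)).1 (hNi.congr (ae_of_all _ fun ω => ?_))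
    simp [hYe]
  have hgi : Integrable (fun ω => g (Y ω)) μ := by
    refine (hTransInt (fun z => g z.2) (by fun_prop)).2 ?_
    have hm : Measurable fun z : ℝ × ℝ => phiG (z.2 - s * z.1) * g z.2 :=
      (phiG_cont.measurable.comp (by fun_prop)).mul (by fun_prop)
    rw [integrable_prod_iff' hm.aestronglyMeasurable]
    refine ⟨ae_of_all _ fun y => (integrable_phiG ν s y).mul_const (g y), ?_⟩
    have hq := hNF.integral_prod_right.norm
    refine hq.congr (ae_of_all _ fun y => ?_)
    simp only [norm_mul, Real.norm_eq_abs, abs_of_pos (phiG_pos _)]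
    rw [integral_mul_const, mul_comm, ← abs_of_pos (density_pos ν s y), ← abs_mul, hgp, abs_neg]
    simp only [mul_comm]
  have hm : MeasurableSpace.comap Y inferInstance ≤ (inferInstance : MeasurableSpace Ω) :=
    hYm.comap_le
  -- the score is minus the conditional mean of the noise
  have hscore : (fun ω => - g (Y ω)) =ᵐ[μ] μ[N | MeasurableSpace.comap Y inferInstance] := by
    refine ae_eq_condExp_of_forall_setIntegral_eq hm hNi (fun _ _ _ => hgi.neg.integrableOn)
      ?_ ?_
    · rintro _ ⟨B, hB, rfl⟩ -
      have hB' : MeasurableSet (Y ⁻¹' B) := hYm hB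
      have hBm : Measurable (B.indicator (1 : ℝ → ℝ)) := measurable_one.indicator hB
      rw [← integral_indicator hB', ← integral_indicator hB']
      have e1 : (Y ⁻¹' B).indicator (fun ω => - g (Y ω)) =
          fun ω => (fun z : ℝ × ℝ => B.indicator (1 : ℝ → ℝ) z.2 * - g z.2) (X ω, Y ω) := by
        ext ω; by_cases h : Y ω ∈ B <;> simp [h]
      have e2 : (Y ⁻¹' B).indicator N =
          fun ω => (fun z : ℝ × ℝ => B.indicator (1 : ℝ → ℝ) z.2 * (z.2 - s * z.1)) (X ω, Y ω) := by
        ext ω; by_cases h : Y ω ∈ B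
        · simp only [Set.indicator, Set.mem_preimage, h, if_true, Pi.one_apply]
          rw [hYe ω]; ring
        · simp only [Set.indicator, Set.mem_preimage, h, if_false]; ring
      have i1 : Integrable ((Y ⁻¹' B).indicator (fun ω => - g (Y ω))) μ := hgi.neg.indicator hB'
      have i2 : Integrable ((Y ⁻¹' B).indicator N) μ := hNi.indicator hB'
      have m1 : Measurable (fun z : ℝ × ℝ => B.indicator (1 : ℝ → ℝ) z.2 * - g z.2) := by fun_prop
      have m2 : Measurable (fun z : ℝ × ℝ => B.indicator (1 : ℝ → ℝ) z.2 * (z.2 - s * z.1)) := by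
        fun_prop
      rw [e1] at i1 ⊢
      rw [e2] at i2 ⊢
      rw [hTransEq _ m1, hTransEq _ m2, integral_prod_symm _ ((hTransInt _ m1).1 i1),
        integral_prod_symm _ ((hTransInt _ m2).1 i2)]
      refine integral_congr_ae (ae_of_all _ fun y => ?_)
      simp only
      rw [integral_mul_const]
      calc _ = B.indicator (1 : ℝ → ℝ) y * -(g y * ∫ x, phiG (y - s * x) ∂ν) := by ring
        _ = ∫ x, B.indicator (1 : ℝ → ℝ) y * ((y - s * x) * phiG (y - s * x)) ∂ν := by
          rw [hgp, neg_neg, integral_const_mul]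
        _ = _ := integral_congr_ae (ae_of_all _ fun x => by simp only; ring)
    · exact ((hgm.neg.comp (comap_measurable Y)).stronglyMeasurable).aestronglyMeasurable
  -- condExp of the noise in terms of the condExp of X
  have hYc : μ[Y | MeasurableSpace.comap Y inferInstance] = Y :=
    condExp_of_stronglyMeasurable hm (comap_measurable Y).stronglyMeasurable hYi
  have hdec : μ[N | MeasurableSpace.comap Y inferInstance] =ᵐ[μ] fun ω => Y ω - s * (μ[X | MeasurableSpace.comap Y inferInstance]) ω := by
    have e : N = Y - s • X := by
      ext ω; simp [hYe]
    have h1 := condExp_sub (m := MeasurableSpace.comap Y inferInstance) hYi (hXi.smul s)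
    have h2 := condExp_smul (μ := μ) s X (MeasurableSpace.comap Y inferInstance)
    rw [← e, hYc] at h1
    filter_upwards [h1, h2] with ω h1 h2
    rw [h1, Pi.sub_apply, h2]; simp
  have hsq : Integrable ((N - μ[N | MeasurableSpace.comap Y inferInstance]) ^ 2) μ :=
    (hN2.sub (hN2.condExp (by norm_num))).integrable_sq
  have hvar := integral_condVar_add_variance_condExp hm hN2
  have hcv := setIntegral_condVar (hm := hm) hsq MeasurableSet.univ
  simp only [Measure.restrict_univ] at hcv
  have hC0 : ∫ ω, (μ[N | MeasurableSpace.comap Y inferInstance]) ω ∂μ = 0 := by rw [integral_condExp hm, hN0]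
  rw [hcv, hNvar, variance_of_integral_eq_zero
    (integrable_condExp.aemeasurable) hC0] at hvar
  have hA : ∫ ω, (g (Y ω)) ^ 2 ∂μ = ∫ ω, (μ[N | MeasurableSpace.comap Y inferInstance]) ω ^ 2 ∂μ := by
    refine integral_congr_ae ?_
    filter_upwards [hscore] with ω h
    rw [← h]; ring
  have hB : ∫ ω, (N ω - (μ[N | MeasurableSpace.comap Y inferInstance]) ω) ^ 2 ∂μ = snr * mmse μ X Y := by
    unfold mmse
    rw [← integral_const_mul]
    refine integral_congr_ae ?_
    filter_upwards [hdec] with ω h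
    rw [h, hYe, ← hs2]; ring
  rw [hA, ← hB]; linarith
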